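/- Let β⃗ be sub-critical. There exists a sufficiently small constant δ > 0 such that for all sufficiently large n: every x ∈ T_δ satisfies ‖A(x)‖_1 < 1 − δ, where A(x) is the M×M matrix with entries A(x)_{ef} = d_TV(π_e(·|x_{f+}), π_e(·|x_{f−})) and ‖·‖_1 is the maximal column ℓ¹-sum. -/

import Mathlib

open Finset MeasureTheory Filter
open scoped ENNReal NNReal

namespace ERGM

/-- The set of edges of the complete graph on `Fin n`: non-diagonal unordered pairs. -/
abbrev EdgeSet (n : ℕ) : Type := {p : Sym2 (Fin n) // ¬ p.IsDiag}

/-- A configuration (graph on `n` vertices): an assignment of `true/false` to each edge. -/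
abbrev Config (n : ℕ) : Type := EdgeSet n → Bool

/-- The value of the configuration `x` on the (unordered) pair `{i,j}`; `false` for `i = j`. -/
noncomputable def edgeVal {n : ℕ} (x : Config n) (i j : Fin n) : Bool :=
  if h : (s(i, j) : Sym2 (Fin n)).IsDiag then false else x ⟨s(i, j), h⟩

/-- Real-valued indicator of presence of the edge `{i,j}` in `x`. -/
noncomputable def edgeInd {n : ℕ} (x : Config n) (i j : Fin n) : ℝ :=
  if edgeVal x i j = true then 1 else 0

open scoped Classical in
/-- Subgraph counting number `N_G(x)`: the number of copies of `G` in `x` (times the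
number of automorphisms), i.e. the sum over injective `ψ` of the product of edge
indicators (each edge indicator is idempotent, so counting ordered adjacent pairs
yields the same value as counting edges). -/
noncomputable def NG {n m : ℕ} (G : SimpleGraph (Fin m)) (x : Config n) : ℝ :=
  ∑ ψ : Fin m ↪ Fin n, ∏ a : Fin m, ∏ b : Fin m,
    if G.Adj a b then edgeInd x (ψ a) (ψ b) else 1

/-- The Hamiltonian `H(x) = Σ_i β_i N_{G_i}(x) / n^{|V_i|-2}`. -/
noncomputable def Hamiltonian {n s : ℕ} (V : Fin s → ℕ)
    (G : ∀ i, SimpleGraph (Fin (V i))) (β : Fin s → ℝ) (x : Config n) : ℝ :=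
  ∑ i, β i * NG (G i) x / (n : ℝ) ^ (V i - 2)

/-- The ERGM probability mass function `π(x) ∝ exp(H(x))`. -/
noncomputable def ergmProb {n s : ℕ} (V : Fin s → ℕ)
    (G : ∀ i, SimpleGraph (Fin (V i))) (β : Fin s → ℝ) (x : Config n) : ℝ :=
  Real.exp (Hamiltonian V G β x) / ∑ y : Config n, Real.exp (Hamiltonian V G β y)

/-- Expectation of `f` with respect to the mass function `w`. -/
noncomputable def expect {n : ℕ} (w : Config n → ℝ) (f : Config n → ℝ) : ℝ :=
  ∑ x : Config n, w x * f x

open scoped Classical in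
/-- Probability of the event `A` with respect to the mass function `w`. -/
noncomputable def prob {n : ℕ} (w : Config n → ℝ) (A : Config n → Prop) : ℝ :=
  ∑ x : Config n, if A x then w x else 0

/-- The number of edges `|E(G)|` of a finite graph. -/
noncomputable def numEdges {m : ℕ} (G : SimpleGraph (Fin m)) : ℕ := G.edgeSet.ncard

/-- `Ψ_β(p) = Σ_i 2 β_i |E_i| p^{|E_i|-1}`. -/
noncomputable def Psi {s : ℕ} (V : Fin s → ℕ) (G : ∀ i, SimpleGraph (Fin (V i)))
    (β : Fin s → ℝ) (p : ℝ) : ℝ :=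
  ∑ i, 2 * β i * (numEdges (G i) : ℝ) * p ^ (numEdges (G i) - 1)

/-- `Φ(u) = e^u / (1 + e^u)`. -/
noncomputable def Phi (u : ℝ) : ℝ := Real.exp u / (1 + Real.exp u)

/-- `φ_β(p) = Φ(Ψ_β(p))`. -/
noncomputable def phiFn {s : ℕ} (V : Fin s → ℕ) (G : ∀ i, SimpleGraph (Fin (V i)))
    (β : Fin s → ℝ) : ℝ → ℝ := fun p => Phi (Psi V G β p)

/-- `β` is sub-critical (high temperature) with fixed point `p`: `p` is the unique
solution of `φ_β(p) = p` and it satisfies `φ_β'(p) < 1`. -/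
def Subcritical {s : ℕ} (V : Fin s → ℕ) (G : ∀ i, SimpleGraph (Fin (V i)))
    (β : Fin s → ℝ) (p : ℝ) : Prop :=
  phiFn V G β p = p ∧ (∀ q : ℝ, phiFn V G β q = q → q = p) ∧
    deriv (phiFn V G β) p < 1

/-- The discrete derivative `∂_e H(x) = H(x_{e+}) - H(x_{e-})`. -/
noncomputable def dHam {n s : ℕ} (V : Fin s → ℕ) (G : ∀ i, SimpleGraph (Fin (V i)))
    (β : Fin s → ℝ) (e : EdgeSet n) (x : Config n) : ℝ :=
  Hamiltonian V G β (Function.update x e true) - Hamiltonian V G β (Function.update x e false)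

/-- Real-valued indicator `X_e` of presence of edge `e`. -/
noncomputable def edgeX {n : ℕ} (e : EdgeSet n) (x : Config n) : ℝ := if x e = true then 1 else 0

/-- Two edges of `K_n` share a vertex. -/
def ShareVertex {n : ℕ} (e f : EdgeSet n) : Prop := ∃ v : Fin n, v ∈ e.1 ∧ v ∈ f.1


/-- The conditional probability `π_e(1 | x̄_e)` that edge `e` is present given the
other coordinates of `x`. -/
noncomputable def condOne {n s : ℕ} (V : Fin s → ℕ) (G : ∀ i, SimpleGraph (Fin (V i)))
    (β : Fin s → ℝ) (x : Config n) (e : EdgeSet n) : ℝ :=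
  ergmProb V G β (Function.update x e true) /
    (ergmProb V G β (Function.update x e true) + ergmProb V G β (Function.update x e false))

open scoped Classical in
/-- `N_G(x,e)`: the number of injective `ψ` such that every edge of `G` maps to an edge
present in `x_{e+}` and some edge of `G` maps onto `e`. -/
noncomputable def NGe {n m : ℕ} (G : SimpleGraph (Fin m)) (x : Config n) (e : EdgeSet n) : ℝ :=
  ∑ ψ : Fin m ↪ Fin n,
    if (∀ a b : Fin m, G.Adj a b → edgeVal (Function.update x e true) (ψ a) (ψ b) = true) ∧
       (∃ a b : Fin m, G.Adj a b ∧ (s(ψ a, ψ b) : Sym2 (Fin n)) = e.1) then 1 else 0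

/-- The normalized subgraph counting number
`r_G(x,e) = (N_G(x,e) / (2|E(G)| n^{|V(G)|-2}))^{1/(|E(G)|-1)}`. -/
noncomputable def rG {n m : ℕ} (G : SimpleGraph (Fin m)) (x : Config n) (e : EdgeSet n) : ℝ :=
  (NGe G x e / (2 * (numEdges G : ℝ) * (n : ℝ) ^ (m - 2))) ^
    ((1 : ℝ) / ((numEdges G : ℝ) - 1))

/-- Membership in the set `T_δ`: all normalized subgraph counting numbers `r_G(x,e)`,
over (nondegenerate) graphs `G` with at most `a` vertices and edges `e` of `K_n`,
lie in `(p* - δ, p* + δ)`. -/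
def memT {n : ℕ} (a : ℕ) (pstar δ : ℝ) (x : Config n) : Prop :=
  ∀ m : ℕ, m ≤ a → ∀ G : SimpleGraph (Fin m), 2 ≤ numEdges G →
    ∀ e : EdgeSet n, pstar - δ < rG G x e ∧ rG G x e < pstar + δ

/-- The `ℓ¹ → ℓ¹` operator norm of a matrix: the maximal column sum of absolute values. -/
noncomputable def colNorm {n : ℕ} (K : EdgeSet n → EdgeSet n → ℝ) : ℝ :=
  ⨆ f : EdgeSet n, ∑ e : EdgeSet n, |K e f|

/-- Every edge of `G` is mapped by `ψ` onto an edge present in `x`. -/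
def Present {n m : ℕ} (G : SimpleGraph (Fin m)) (x : Config n) (ψ : Fin m ↪ Fin n) : Prop :=
  ∀ a b : Fin m, G.Adj a b → edgeVal x (ψ a) (ψ b) = true

/-- Some edge of `G` is mapped by `ψ` onto `e`. -/
def Covers {n m : ℕ} (G : SimpleGraph (Fin m)) (ψ : Fin m ↪ Fin n) (e : EdgeSet n) : Prop :=
  ∃ a b : Fin m, G.Adj a b ∧ (s(ψ a, ψ b) : Sym2 (Fin n)) = e.1

open scoped Classical in
/-- The number of embeddings of `G` into `x` with `e` and `f` added that use both `e` and `f`. -/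
noncomputable def NGpair {n m : ℕ} (G : SimpleGraph (Fin m)) (x : Config n)
    (e f : EdgeSet n) : ℝ :=
  ∑ ψ : Fin m ↪ Fin n,
    if Present G (Function.update (Function.update x f true) e true) ψ ∧
      Covers G ψ e ∧ Covers G ψ f then 1 else 0

theorem edgeVal_update_of_eq {n : ℕ} (x : Config n) (e : EdgeSet n) (b : Bool) {i j : Fin n}
    (h : (s(i, j) : Sym2 (Fin n)) = e.1) : edgeVal (Function.update x e b) i j = b := by
  have hd : ¬ (s(i, j) : Sym2 (Fin n)).IsDiag := h ▸ e.2
  have he : (⟨s(i, j), hd⟩ : EdgeSet n) = e := Subtype.ext h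
  unfold edgeVal
  rw [dif_neg hd, he, Function.update_self]

theorem edgeVal_update_of_ne {n : ℕ} (x : Config n) (e : EdgeSet n) (b : Bool) {i j : Fin n}
    (h : (s(i, j) : Sym2 (Fin n)) ≠ e.1) :
    edgeVal (Function.update x e b) i j = edgeVal x i j := by
  unfold edgeVal
  split_ifs with hd
  · rfl
  · exact Function.update_of_ne (fun h' => h (congrArg Subtype.val h')) _ _

theorem present_update_false {n m : ℕ} (G : SimpleGraph (Fin m)) (x : Config n)
    (ψ : Fin m ↪ Fin n) (e : EdgeSet n) :
    Present G (Function.update x e false) ψ ↔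
      Present G (Function.update x e true) ψ ∧ ¬ Covers G ψ e := by
  constructor
  · intro h
    refine ⟨fun a b hab => ?_, ?_⟩
    · by_cases hs : (s(ψ a, ψ b) : Sym2 (Fin n)) = e.1
      · exact edgeVal_update_of_eq x e true hs
      · have := h a b hab
        rwa [edgeVal_update_of_ne x e _ hs] at this ⊢
    · rintro ⟨a, b, hab, hs⟩
      have := h a b hab
      rw [edgeVal_update_of_eq x e _ hs] at this
      exact Bool.false_ne_true this
  · rintro ⟨h, hc⟩ a b hab
    have hs : (s(ψ a, ψ b) : Sym2 (Fin n)) ≠ e.1 := fun hs => hc ⟨a, b, hab, hs⟩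
    have := h a b hab
    rwa [edgeVal_update_of_ne x e _ hs] at this ⊢

open scoped Classical in
theorem NG_eq_sum_present {n m : ℕ} (G : SimpleGraph (Fin m)) (x : Config n) :
    NG G x = ∑ ψ : Fin m ↪ Fin n, if Present G x ψ then (1 : ℝ) else 0 := by
  unfold NG
  refine Finset.sum_congr rfl fun ψ _ => ?_
  split_ifs with h
  · refine Finset.prod_eq_one fun a _ => Finset.prod_eq_one fun b _ => ?_
    split_ifs with hab
    · simp [edgeInd, h a b hab]
    · rfl
  · unfold Present at h
    push Not at h
    obtain ⟨a, b, hab, hv⟩ := h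
    refine Finset.prod_eq_zero (Finset.mem_univ a) (Finset.prod_eq_zero (Finset.mem_univ b) ?_)
    simp [hab, edgeInd, hv]

open scoped Classical in
theorem NGe_eq_sum {n m : ℕ} (G : SimpleGraph (Fin m)) (x : Config n) (e : EdgeSet n) :
    NGe G x e = ∑ ψ : Fin m ↪ Fin n,
      if Present G (Function.update x e true) ψ ∧ Covers G ψ e then (1 : ℝ) else 0 :=
  Finset.sum_congr rfl fun _ _ => if_congr Iff.rfl rfl rfl

theorem NGe_nonneg {n m : ℕ} (G : SimpleGraph (Fin m)) (x : Config n) (e : EdgeSet n) :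
    0 ≤ NGe G x e := by
  classical
  rw [NGe_eq_sum]
  exact Finset.sum_nonneg fun ψ _ => by split_ifs <;> norm_num

theorem NGpair_nonneg {n m : ℕ} (G : SimpleGraph (Fin m)) (x : Config n) (e f : EdgeSet n) :
    0 ≤ NGpair G x e f := by
  classical
  exact Finset.sum_nonneg fun ψ _ => by split_ifs <;> norm_num

theorem NG_update_sub {n m : ℕ} (G : SimpleGraph (Fin m)) (x : Config n) (e : EdgeSet n) :
    NG G (Function.update x e true) - NG G (Function.update x e false) = NGe G x e := by
  classical
  rw [NG_eq_sum_present, NG_eq_sum_present, NGe_eq_sum, ← Finset.sum_sub_distrib]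
  refine Finset.sum_congr rfl fun ψ _ => ?_
  rw [present_update_false]
  by_cases h₁ : Present G (Function.update x e true) ψ <;> by_cases h₂ : Covers G ψ e <;>
    simp [h₁, h₂]

theorem NGe_update_sub {n m : ℕ} (G : SimpleGraph (Fin m)) (x : Config n) {e f : EdgeSet n}
    (hef : e ≠ f) :
    NGe G (Function.update x f true) e - NGe G (Function.update x f false) e =
      NGpair G x e f := by
  classical
  rw [NGe_eq_sum, NGe_eq_sum, NGpair, ← Finset.sum_sub_distrib]
  refine Finset.sum_congr rfl fun ψ _ => ?_
  have hc : ∀ b : Bool, Function.update (Function.update x f b) e true =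
      Function.update (Function.update x e true) f b := fun b =>
    Function.update_comm hef.symm b true x
  rw [hc, hc, present_update_false]
  by_cases h₁ : Present G (Function.update (Function.update x e true) f true) ψ <;>
    by_cases h₂ : Covers G ψ e <;> by_cases h₃ : Covers G ψ f <;> simp [h₁, h₂, h₃]

open scoped Classical in
theorem card_embedding_mapsTo_le {n m : ℕ} (t : Finset (Fin m)) (U : Finset (Fin n)) :
    (Finset.univ.filter fun ψ : Fin m ↪ Fin n => ∀ i ∈ t, ψ i ∈ U).card ≤
      U.card ^ t.card * n ^ (m - t.card) := by
  have h : (Finset.univ.filter fun ψ : Fin m ↪ Fin n => ∀ i ∈ t, ψ i ∈ U).card ≤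
      (Fintype.piFinset fun i : Fin m => if i ∈ t then U else Finset.univ).card := by
    refine Finset.card_le_card_of_injOn (fun ψ => ⇑ψ) ?_ DFunLike.coe_injective.injOn
    intro ψ hψ
    simp only [Finset.coe_filter, Finset.mem_univ, true_and, Set.mem_ofPred_eq] at hψ
    simp only [Finset.mem_coe, Fintype.mem_piFinset]
    intro i
    split_ifs with hi
    · exact hψ i hi
    · exact Finset.mem_univ _
  refine h.trans_eq ?_
  rw [Fintype.card_piFinset]
  have : ∀ i : Fin m, (if i ∈ t then U else Finset.univ).card = if i ∈ t then U.card else n := by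
    intro i; split_ifs <;> simp
  simp_rw [this]
  rw [Finset.prod_ite, Finset.prod_const, Finset.prod_const]
  congr 2
  · simp
  · rw [Finset.filter_not, Finset.card_sdiff_of_subset (Finset.filter_subset _ _)]
    simp

theorem exists_card_three_of_covers {n m : ℕ} {G : SimpleGraph (Fin m)} {ψ : Fin m ↪ Fin n}
    {e f : EdgeSet n} (hef : e ≠ f) (he : Covers G ψ e) (hf : Covers G ψ f) :
    ∃ t ∈ Finset.powersetCard 3 (Finset.univ : Finset (Fin m)),
      ∀ i ∈ t, ψ i ∈ e.1.toFinset ∪ f.1.toFinset := by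
  obtain ⟨a, b, hab, hs⟩ := he
  obtain ⟨c, d, hcd, hs'⟩ := hf
  have key : ∃ k, k ≠ a ∧ k ≠ b ∧ ψ k ∈ f.1 := by
    by_contra! hk
    have hc : ψ c ∈ f.1 := by rw [← hs']; simp
    have hd : ψ d ∈ f.1 := by rw [← hs']; simp
    have hne := hcd.ne
    refine hef (Subtype.ext ?_)
    rw [← hs, ← hs']
    by_cases hca : c = a
    · by_cases hdb : d = b
      · rw [hca, hdb]
      · exact absurd hd (hk d (fun h => hne (hca.trans h.symm)) hdb)
    · by_cases hcb : c = b
      · by_cases hda : d = a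
        · rw [hcb, hda, Sym2.eq_swap]
        · exact absurd hd (hk d hda (fun h => hne (hcb.trans h.symm)))
      · exact absurd hc (hk c hca hcb)
  obtain ⟨k, hka, hkb, hk⟩ := key
  refine ⟨{a, b, k}, ?_, ?_⟩
  · rw [Finset.mem_powersetCard]
    exact ⟨Finset.subset_univ _, Finset.card_eq_three.2
      ⟨a, b, k, hab.ne, hka.symm, hkb.symm, rfl⟩⟩
  · intro i hi
    simp only [Finset.mem_insert, Finset.mem_singleton] at hi
    rw [Finset.mem_union, Sym2.mem_toFinset, Sym2.mem_toFinset]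
    rcases hi with rfl | rfl | rfl
    · left; rw [← hs]; simp
    · left; rw [← hs]; simp
    · right; exact hk

theorem NGpair_le {n m : ℕ} (G : SimpleGraph (Fin m)) (x : Config n) {e f : EdgeSet n}
    (hef : e ≠ f) : NGpair G x e f ≤ (m.choose 3 * (64 * n ^ (m - 3)) : ℕ) := by
  classical
  have hU : (e.1.toFinset ∪ f.1.toFinset).card ≤ 4 := by
    refine (Finset.card_union_le _ _).trans ?_
    rw [Sym2.card_toFinset_of_not_isDiag _ e.2, Sym2.card_toFinset_of_not_isDiag _ f.2]
  unfold NGpair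
  rw [Finset.sum_boole, Nat.cast_le]
  calc _ ≤ ((Finset.powersetCard 3 (Finset.univ : Finset (Fin m))).biUnion fun t =>
        Finset.univ.filter fun ψ : Fin m ↪ Fin n =>
          ∀ i ∈ t, ψ i ∈ e.1.toFinset ∪ f.1.toFinset).card := by
        refine Finset.card_le_card fun ψ hψ => ?_
        simp only [Finset.mem_filter, Finset.mem_univ, true_and] at hψ
        obtain ⟨t, ht, h⟩ := exists_card_three_of_covers hef hψ.2.1 hψ.2.2
        exact Finset.mem_biUnion.2 ⟨t, ht, by simpa using h⟩
    _ ≤ (Finset.powersetCard 3 (Finset.univ : Finset (Fin m))).card * (64 * n ^ (m - 3)) := by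
        refine Finset.card_biUnion_le_card_mul _ _ _ fun t ht => ?_
        refine (card_embedding_mapsTo_le t _).trans ?_
        rw [(Finset.mem_powersetCard.1 ht).2]
        refine Nat.mul_le_mul_right _ ?_
        calc _ ≤ 4 ^ 3 := Nat.pow_le_pow_left hU 3
          _ = 64 := by norm_num
    _ = _ := by rw [Finset.card_powersetCard, Finset.card_univ, Fintype.card_fin]

theorem NGpair_div_le {n m : ℕ} (hn : 0 < n) (G : SimpleGraph (Fin m)) (x : Config n)
    {e f : EdgeSet n} (hef : e ≠ f) :
    NGpair G x e f / (n : ℝ) ^ (m - 2) ≤ (64 * m.choose 3 : ℕ) / (n : ℝ) := by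
  have hn' : (0 : ℝ) < n := by exact_mod_cast hn
  rw [div_le_div_iff₀ (by positivity) hn']
  refine (mul_le_mul_of_nonneg_right (NGpair_le G x hef) hn'.le).trans_eq ?_
  rcases Nat.lt_or_ge m 3 with hm | hm
  · simp [Nat.choose_eq_zero_of_lt hm]
  · obtain ⟨k, rfl⟩ := Nat.exists_eq_add_of_le' hm
    rw [show k + 3 - 3 = k by omega, show k + 3 - 2 = k + 1 by omega]
    push_cast
    ring

open scoped Classical in
theorem sum_NGpair_le {n m : ℕ} (G : SimpleGraph (Fin m)) (x : Config n) (f : EdgeSet n) :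
    ∑ e ∈ Finset.univ.erase f, NGpair G x e f ≤
      ∑ ε ∈ G.edgeSet.toFinset, NGe (G.deleteEdges {ε}) x f := by
  have key : ∀ e ∈ Finset.univ.erase f, ∀ ψ : Fin m ↪ Fin n,
      (if Present G (Function.update (Function.update x f true) e true) ψ ∧
        Covers G ψ e ∧ Covers G ψ f then (1 : ℝ) else 0) ≤
      ∑ ε ∈ G.edgeSet.toFinset,
        (if Present (G.deleteEdges {ε}) (Function.update x f true) ψ ∧
          Covers (G.deleteEdges {ε}) ψ f then (1 : ℝ) else 0) *
        (if ε.map ψ = e.1 then 1 else 0) := by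
    intro e he ψ
    have hef : e ≠ f := Finset.ne_of_mem_erase he
    have hnn : ∀ ε ∈ G.edgeSet.toFinset, (0 : ℝ) ≤
        (if Present (G.deleteEdges {ε}) (Function.update x f true) ψ ∧
          Covers (G.deleteEdges {ε}) ψ f then (1 : ℝ) else 0) *
        (if ε.map ψ = e.1 then 1 else 0) := by
      intro ε _
      refine mul_nonneg ?_ ?_ <;> split_ifs <;> norm_num
    split_ifs with h
    swap
    · exact Finset.sum_nonneg hnn
    obtain ⟨hp, ⟨a, b, hab, hs⟩, c, d, hcd, hs'⟩ := h
    have hmem : s(a, b) ∈ G.edgeSet.toFinset := by simpa using hab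
    refine le_trans (le_of_eq ?_) (Finset.single_le_sum hnn hmem)
    have h₁ : Present (G.deleteEdges {s(a, b)}) (Function.update x f true) ψ := by
      intro u v huv
      rw [SimpleGraph.deleteEdges_adj] at huv
      have hne : (s(ψ u, ψ v) : Sym2 (Fin n)) ≠ e.1 := by
        rw [← hs]
        exact fun h => huv.2 (Sym2.map.injective ψ.injective h)
      have := hp u v huv.1
      rwa [edgeVal_update_of_ne _ _ _ hne] at this
    have h₂ : Covers (G.deleteEdges {s(a, b)}) ψ f := by
      refine ⟨c, d, ?_, hs'⟩
      rw [SimpleGraph.deleteEdges_adj]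
      refine ⟨hcd, fun h => hef (Subtype.ext ?_)⟩
      rw [← hs, ← hs']
      exact (congrArg (Sym2.map ψ) h).symm
    rw [if_pos ⟨h₁, h₂⟩, if_pos (by simpa using hs), mul_one]
  calc _ ≤ ∑ e ∈ Finset.univ.erase f, ∑ ψ : Fin m ↪ Fin n, ∑ ε ∈ G.edgeSet.toFinset,
        (if Present (G.deleteEdges {ε}) (Function.update x f true) ψ ∧
          Covers (G.deleteEdges {ε}) ψ f then (1 : ℝ) else 0) *
        (if ε.map ψ = e.1 then 1 else 0) :=
        Finset.sum_le_sum fun e he => Finset.sum_le_sum fun ψ _ => key e he ψ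
    _ = ∑ ε ∈ G.edgeSet.toFinset, ∑ ψ : Fin m ↪ Fin n,
        (if Present (G.deleteEdges {ε}) (Function.update x f true) ψ ∧
          Covers (G.deleteEdges {ε}) ψ f then (1 : ℝ) else 0) *
        ∑ e ∈ Finset.univ.erase f, (if ε.map ψ = e.1 then 1 else 0) := by
        rw [Finset.sum_congr rfl fun e _ => Finset.sum_comm, Finset.sum_comm]
        refine Finset.sum_congr rfl fun ε _ => ?_
        rw [Finset.sum_comm]
        exact Finset.sum_congr rfl fun ψ _ => (Finset.mul_sum _ _ _).symm
    _ ≤ _ := by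
        refine Finset.sum_le_sum fun ε _ => ?_
        rw [NGe_eq_sum]
        refine Finset.sum_le_sum fun ψ _ => ?_
        refine mul_le_of_le_one_right (by split_ifs <;> norm_num) ?_
        rw [Finset.sum_boole]
        norm_cast
        refine Finset.card_le_one.2 fun e he e' he' => ?_
        simp only [Finset.mem_filter] at he he'
        exact Subtype.ext (he.2.symm.trans he'.2)

open scoped Classical in
/-- The number of embeddings that map the pair `{a, b}` onto `e`. -/
noncomputable def edgeEmbCount {n m : ℕ} (a b : Fin m) (e : EdgeSet n) : ℕ :=
  (Finset.univ.filter fun ψ : Fin m ↪ Fin n => (s(ψ a, ψ b) : Sym2 (Fin n)) = e.1).card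

theorem edgeEmbCount_le {n m : ℕ} (a b : Fin m) (e e' : EdgeSet n) :
    edgeEmbCount a b e ≤ edgeEmbCount a b e' := by
  classical
  obtain ⟨e, he⟩ := e
  obtain ⟨e', he'⟩ := e'
  induction e using Sym2.ind with | _ u v => ?_
  induction e' using Sym2.ind with | _ u' v' => ?_
  rw [Sym2.mk_isDiag_iff] at he he'
  have hinj : ∀ {w z : Fin n}, w ≠ z → Function.Injective ![w, z] := by
    intro w z hwz i j
    fin_cases i <;> fin_cases j <;> simp [hwz, hwz.symm]
  obtain ⟨σ, hσ⟩ := Equiv.Perm.exists_extending_pair ![u, v] ![u', v'] (hinj he) (hinj he')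
  have hu : σ u = u' := by simpa using hσ 0
  have hv : σ v = v' := by simpa using hσ 1
  refine Finset.card_le_card_of_injOn (fun ψ => ψ.trans σ.toEmbedding) ?_ ?_
  · intro ψ hψ
    simp only [Finset.coe_filter, Finset.mem_univ, true_and, Set.mem_ofPred_eq] at hψ ⊢
    have := congrArg (Sym2.map σ) hψ
    simpa [hu, hv] using this
  · intro ψ _ ψ' _ h
    ext i
    have := DFunLike.congr_fun h i
    simpa using congrArg Fin.val (σ.injective this)

theorem sum_edgeEmbCount {n m : ℕ} {a b : Fin m} (hab : a ≠ b) :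
    ∑ e : EdgeSet n, edgeEmbCount a b e = n.descFactorial m := by
  classical
  have hmem : ∀ ψ : Fin m ↪ Fin n, ¬ (s(ψ a, ψ b) : Sym2 (Fin n)).IsDiag := fun ψ => by
    rw [Sym2.mk_isDiag_iff]
    exact fun h => hab (ψ.injective h)
  have h := Finset.card_eq_sum_card_fiberwise (s := (Finset.univ : Finset (Fin m ↪ Fin n)))
    (t := (Finset.univ : Finset (EdgeSet n))) (f := fun ψ => ⟨s(ψ a, ψ b), hmem ψ⟩)
    (fun _ _ => Finset.mem_coe.2 (Finset.mem_univ _))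
  rw [Finset.card_univ, Fintype.card_embedding_eq, Fintype.card_fin, Fintype.card_fin] at h
  rw [h]
  refine Finset.sum_congr rfl fun e _ => ?_
  unfold edgeEmbCount
  congr 1
  ext ψ
  simp [Subtype.ext_iff]

theorem edgeEmbCount_eq {n m : ℕ} {a b : Fin m} (hab : a ≠ b) (e : EdgeSet n) :
    edgeEmbCount a b e = 2 * (n - 2).descFactorial (m - 2) := by
  have hcard : n.choose 2 * edgeEmbCount a b e = n.descFactorial m := by
    rw [← sum_edgeEmbCount hab, Finset.sum_congr rfl fun e' _ =>
      le_antisymm (edgeEmbCount_le a b e' e) (edgeEmbCount_le a b e e')]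
    rw [Finset.sum_const, Finset.card_univ, Sym2.card_subtype_not_diag, Fintype.card_fin,
      smul_eq_mul]
  have hm : 2 ≤ m := by
    have := Fin.val_ne_of_ne hab
    omega
  have hn : 0 < n.choose 2 := by
    have : 0 < Fintype.card (EdgeSet n) := Fintype.card_pos_iff.2 ⟨e⟩
    rwa [Sym2.card_subtype_not_diag, Fintype.card_fin] at this
  have hn2 : 2 ≤ n := by
    by_contra h
    exact hn.ne' (Nat.choose_eq_zero_of_lt (by omega))
  obtain ⟨k, rfl⟩ := Nat.exists_eq_add_of_le' hm
  obtain ⟨l, rfl⟩ := Nat.exists_eq_add_of_le' hn2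
  refine Nat.eq_of_mul_eq_mul_left hn ?_
  rw [hcard, Nat.add_sub_cancel, Nat.add_sub_cancel, Nat.succ_descFactorial_succ,
    Nat.succ_descFactorial_succ, ← mul_assoc, ← mul_assoc, Nat.choose_two_right,
    Nat.div_mul_cancel (Nat.even_mul_pred_self _).two_dvd]
  rfl

theorem NGe_eq_of_numEdges_eq_one {n m : ℕ} {H : SimpleGraph (Fin m)} (hH : numEdges H = 1)
    (x : Config n) (e : EdgeSet n) : NGe H x e = 2 * ((n - 2).descFactorial (m - 2) : ℕ) := by
  classical
  obtain ⟨ε, hε⟩ := Set.ncard_eq_one.1 hH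
  induction ε using Sym2.ind with | _ a b => ?_
  have hadj : ∀ c d, H.Adj c d ↔ s(c, d) = s(a, b) := fun c d => by
    rw [← SimpleGraph.mem_edgeSet, hε, Set.mem_singleton_iff]
  have hab : a ≠ b := ((hadj a b).2 rfl).ne
  have hmap : ∀ (ψ : Fin m ↪ Fin n) (c d : Fin m), H.Adj c d →
      (s(ψ c, ψ d) : Sym2 (Fin n)) = s(ψ a, ψ b) := fun ψ c d h =>
    congrArg (Sym2.map ψ) ((hadj c d).1 h)
  have hiff : ∀ ψ : Fin m ↪ Fin n,
      (Present H (Function.update x e true) ψ ∧ Covers H ψ e) ↔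
        (s(ψ a, ψ b) : Sym2 (Fin n)) = e.1 := by
    intro ψ
    constructor
    · rintro ⟨-, c, d, hcd, hs⟩
      rw [← hmap ψ c d hcd, hs]
    · intro hs
      exact ⟨fun c d hcd => edgeVal_update_of_eq x e true ((hmap ψ c d hcd).trans hs),
        a, b, (hadj a b).2 rfl, hs⟩
  rw [NGe_eq_sum]
  simp_rw [hiff]
  rw [Finset.sum_boole]
  have := edgeEmbCount_eq hab e
  unfold edgeEmbCount at this
  rw [this]
  push_cast
  rfl

theorem NGe_eq_of_numEdges_eq_zero {n m : ℕ} {H : SimpleGraph (Fin m)} (hH : numEdges H = 0)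
    (x : Config n) (e : EdgeSet n) : NGe H x e = 0 := by
  classical
  rw [NGe_eq_sum]
  refine Finset.sum_eq_zero fun ψ _ => if_neg ?_
  rintro ⟨-, a, b, hab, -⟩
  have h : H.edgeSet = ∅ := (Set.ncard_eq_zero (Set.toFinite _)).1 hH
  exact (h ▸ (H.mem_edgeSet.2 hab) : s(a, b) ∈ (∅ : Set (Sym2 (Fin m))))

theorem rG_pow {n m : ℕ} {H : SimpleGraph (Fin m)} (hH : 2 ≤ numEdges H) (x : Config n)
    (e : EdgeSet n) : 0 ≤ rG H x e ∧ rG H x e ^ (numEdges H - 1) =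
      NGe H x e / (2 * (numEdges H : ℝ) * (n : ℝ) ^ (m - 2)) := by
  have h0 : 0 ≤ NGe H x e / (2 * (numEdges H : ℝ) * (n : ℝ) ^ (m - 2)) :=
    div_nonneg (NGe_nonneg H x e) (by positivity)
  refine ⟨Real.rpow_nonneg h0 _, ?_⟩
  have hc : (numEdges H : ℝ) - 1 = ((numEdges H - 1 : ℕ) : ℝ) := by
    rw [Nat.cast_sub (by omega), Nat.cast_one]
  rw [rG, hc, one_div]
  exact Real.rpow_inv_natCast_pow h0 (by omega)

theorem NGe_div_le_of_memT {n m a : ℕ} (hn : 0 < n) {p δ : ℝ} {x : Config n}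
    (hx : memT a p δ x) (hm : m ≤ a) (H : SimpleGraph (Fin m)) (e : EdgeSet n) :
    NGe H x e / (n : ℝ) ^ (m - 2) ≤ 2 * numEdges H * (p + δ) ^ (numEdges H - 1) := by
  have hn' : (0 : ℝ) < (n : ℝ) ^ (m - 2) := by positivity
  rcases Nat.lt_or_ge (numEdges H) 2 with h | h
  · have : numEdges H = 0 ∨ numEdges H = 1 := by omega
    rcases this with h | h
    · simp [NGe_eq_of_numEdges_eq_zero h, h]
    · rw [NGe_eq_of_numEdges_eq_one h, div_le_iff₀ hn', h]
      have : (n - 2).descFactorial (m - 2) ≤ n ^ (m - 2) :=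
        (Nat.descFactorial_le_pow _ _).trans (Nat.pow_le_pow_left (Nat.sub_le _ _) _)
      have : (((n - 2).descFactorial (m - 2) : ℕ) : ℝ) ≤ (n : ℝ) ^ (m - 2) := by
        exact_mod_cast this
      simpa using this
  · obtain ⟨h0, hr⟩ := rG_pow h x e
    have hE : (0 : ℝ) < 2 * numEdges H := by
      have : 0 < numEdges H := by omega
      positivity
    have := pow_le_pow_left₀ h0 (hx m hm H h e).2.le (numEdges H - 1)
    rw [hr, ← div_div, div_right_comm, div_le_iff₀ hE] at this
    linarith

theorem le_NGe_div_of_memT {n m a : ℕ} (hn : 0 < n) {p δ : ℝ} (hp : 0 ≤ p - δ) {x : Config n}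
    (hx : memT a p δ x) (hm : m ≤ a) (H : SimpleGraph (Fin m)) (e : EdgeSet n) :
    2 * numEdges H * (p - δ) ^ (numEdges H - 1) *
        (((n - 2).descFactorial (m - 2) : ℕ) / (n : ℝ) ^ (m - 2)) ≤
      NGe H x e / (n : ℝ) ^ (m - 2) := by
  have hn' : (0 : ℝ) < (n : ℝ) ^ (m - 2) := by positivity
  rcases Nat.lt_or_ge (numEdges H) 2 with h | h
  · have : numEdges H = 0 ∨ numEdges H = 1 := by omega
    rcases this with h | h
    · simp [NGe_eq_of_numEdges_eq_zero h, h]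
    · rw [NGe_eq_of_numEdges_eq_one h, h]
      exact le_of_eq (by simp; ring)
  · obtain ⟨h0, hr⟩ := rG_pow h x e
    have hE : (0 : ℝ) < 2 * numEdges H := by
      have : 0 < numEdges H := by omega
      positivity
    have hle : (n - 2).descFactorial (m - 2) ≤ n ^ (m - 2) :=
      (Nat.descFactorial_le_pow _ _).trans (Nat.pow_le_pow_left (Nat.sub_le _ _) _)
    have hc : (((n - 2).descFactorial (m - 2) : ℕ) / (n : ℝ) ^ (m - 2)) ≤ 1 := by
      rw [div_le_one hn']
      exact_mod_cast hle
    refine (mul_le_of_le_one_right (by positivity) hc).trans ?_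
    have := pow_le_pow_left₀ hp (hx m hm H h e).1.le (numEdges H - 1)
    rw [hr, ← div_div, div_right_comm, le_div_iff₀ hE] at this
    linarith

theorem tendsto_descFactorial_sub_two_div_pow (k : ℕ) :
    Tendsto (fun n : ℕ => (((n - 2).descFactorial k : ℕ) : ℝ) / (n : ℝ) ^ k) atTop (nhds 1) := by
  rw [← tendsto_add_atTop_iff_nat 2]
  have h₁ : Tendsto (fun n : ℕ => ((n.descFactorial k : ℕ) : ℝ) / (n : ℝ) ^ k) atTop (nhds 1) := by
    refine (Asymptotics.isEquivalent_iff_tendsto_one ?_).1 (isEquivalent_descFactorial k)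
    filter_upwards [eventually_gt_atTop 0] with n hn
    positivity
  have h₂ : Tendsto (fun n : ℕ => ((n : ℝ) / ((n + 2 : ℕ) : ℝ)) ^ k) atTop (nhds 1) := by
    have := (tendsto_natCast_div_add_atTop (2 : ℝ)).pow k
    simpa using this
  have h₃ := h₁.mul h₂
  rw [mul_one] at h₃
  refine h₃.congr' ?_
  filter_upwards [eventually_gt_atTop 0] with n hn
  rw [Nat.add_sub_cancel, div_pow, div_mul_div_cancel₀ (by positivity)]

theorem numEdges_deleteEdges_singleton {m : ℕ} (G : SimpleGraph (Fin m)) {ε : Sym2 (Fin m)}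
    (hε : ε ∈ G.edgeSet) : numEdges (G.deleteEdges {ε}) = numEdges G - 1 := by
  rw [numEdges, SimpleGraph.edgeSet_deleteEdges, Set.ncard_sdiff_singleton_of_mem hε, numEdges]

theorem sum_NGpair_div_le_of_memT {n m a : ℕ} (hn : 0 < n) {p δ : ℝ} {x : Config n}
    (hx : memT a p δ x) (hm : m ≤ a) (G : SimpleGraph (Fin m)) (f : EdgeSet n) :
    ∑ e ∈ Finset.univ.erase f, NGpair G x e f / (n : ℝ) ^ (m - 2) ≤
      numEdges G * (2 * ((numEdges G - 1 : ℕ) : ℝ) * (p + δ) ^ (numEdges G - 1 - 1)) := by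
  classical
  rw [← Finset.sum_div]
  refine (div_le_div_of_nonneg_right (sum_NGpair_le G x f) (by positivity)).trans ?_
  rw [Finset.sum_div]
  refine (Finset.sum_le_card_nsmul _ _
    (2 * ((numEdges G - 1 : ℕ) : ℝ) * (p + δ) ^ (numEdges G - 1 - 1)) fun ε hε => ?_).trans_eq ?_
  · have := NGe_div_le_of_memT hn hx hm (G.deleteEdges {ε}) f
    rwa [numEdges_deleteEdges_singleton G (by simpa using hε)] at this
  · rw [nsmul_eq_mul, numEdges, Set.ncard_eq_toFinset_card']

theorem Phi_mem_Ioo (u : ℝ) : 0 < Phi u ∧ Phi u < 1 := by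
  unfold Phi
  have := Real.exp_pos u
  exact ⟨by positivity, (div_lt_one (by positivity)).2 (by linarith)⟩

theorem hasDerivAt_Phi (u : ℝ) : HasDerivAt Phi (Phi u * (1 - Phi u)) u := by
  have hpos : (1 + Real.exp u) ≠ 0 := by positivity
  have h := (Real.hasDerivAt_exp u).div ((Real.hasDerivAt_exp u).const_add 1) hpos
  refine h.congr_deriv ?_
  unfold Phi
  field_simp

theorem continuous_Phi : Continuous Phi :=
  continuous_iff_continuousAt.2 fun u => (hasDerivAt_Phi u).continuousAt

theorem monotone_Phi : Monotone Phi :=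
  monotone_of_hasDerivAt_nonneg hasDerivAt_Phi fun u =>
    mul_nonneg (Phi_mem_Ioo u).1.le (sub_nonneg.2 (Phi_mem_Ioo u).2.le)

theorem Phi_zero : Phi 0 = 1 / 2 := by
  norm_num [Phi]

/-- On the nonnegative half-line, where `Phi` is concave, its increments are controlled by its
derivative at any point to the left. -/
theorem abs_Phi_sub_le {l u v : ℝ} (hl : 0 ≤ l) (hu : l ≤ u) (hv : l ≤ v) :
    |Phi v - Phi u| ≤ Phi l * (1 - Phi l) * |v - u| := by
  refine (convex_Ici l).norm_image_sub_le_of_norm_hasDerivWithin_le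
    (fun w _ => (hasDerivAt_Phi w).hasDerivWithinAt) (fun w hw => ?_) hu hv
  have h₁ := monotone_Phi (Set.mem_Ici.1 hw)
  have h₂ : 1 / 2 ≤ Phi l := Phi_zero ▸ monotone_Phi hl
  rw [Real.norm_of_nonneg (mul_nonneg (Phi_mem_Ioo w).1.le (sub_nonneg.2 (Phi_mem_Ioo w).2.le))]
  nlinarith

/-- The derivative of `Psi`. -/
noncomputable def PsiDeriv {s : ℕ} (V : Fin s → ℕ) (G : ∀ i, SimpleGraph (Fin (V i)))
    (β : Fin s → ℝ) (p : ℝ) : ℝ :=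
  ∑ i, 2 * β i * (numEdges (G i) : ℝ) *
    (((numEdges (G i) - 1 : ℕ) : ℝ) * p ^ (numEdges (G i) - 1 - 1))

section
variable {s : ℕ} (V : Fin s → ℕ) (G : ∀ i, SimpleGraph (Fin (V i))) (β : Fin s → ℝ)

theorem hasDerivAt_Psi (p : ℝ) : HasDerivAt (Psi V G β) (PsiDeriv V G β p) p :=
  HasDerivAt.fun_sum fun i _ => (hasDerivAt_pow (numEdges (G i) - 1) p).const_mul _

theorem continuous_Psi : Continuous (Psi V G β) := by
  unfold Psi
  fun_prop

theorem continuous_PsiDeriv : Continuous (PsiDeriv V G β) := by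
  unfold PsiDeriv
  fun_prop

theorem deriv_phiFn (p : ℝ) : deriv (phiFn V G β) p =
    Phi (Psi V G β p) * (1 - Phi (Psi V G β p)) * PsiDeriv V G β p :=
  ((hasDerivAt_Phi _).comp p (hasDerivAt_Psi V G β p)).deriv

theorem dHam_eq_sum {n : ℕ} (e : EdgeSet n) (x : Config n) :
    dHam V G β e x = ∑ i, β i * (NGe (G i) x e / (n : ℝ) ^ (V i - 2)) := by
  unfold dHam Hamiltonian
  rw [← Finset.sum_sub_distrib]
  refine Finset.sum_congr rfl fun i _ => ?_
  rw [← NG_update_sub]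
  ring

theorem condOne_eq_Phi_dHam {n : ℕ} (x : Config n) (e : EdgeSet n) :
    condOne V G β x e = Phi (dHam V G β e x) := by
  unfold condOne ergmProb dHam Phi
  have hZ : 0 < ∑ y : Config n, Real.exp (Hamiltonian V G β y) :=
    Finset.sum_pos (fun y _ => Real.exp_pos _) Finset.univ_nonempty
  rw [Real.exp_sub, ← add_div, div_div_div_cancel_right₀ hZ.ne']
  have h₁ := Real.exp_pos (Hamiltonian V G β (Function.update x e true))
  have h₂ := Real.exp_pos (Hamiltonian V G β (Function.update x e false))
  field_simp
  ring

theorem dHam_update_sub {n : ℕ} (x : Config n) {e f : EdgeSet n} (hef : e ≠ f) :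
    dHam V G β e (Function.update x f true) - dHam V G β e (Function.update x f false) =
      ∑ i, β i * (NGpair (G i) x e f / (n : ℝ) ^ (V i - 2)) := by
  rw [dHam_eq_sum, dHam_eq_sum, ← Finset.sum_sub_distrib]
  refine Finset.sum_congr rfl fun i _ => ?_
  rw [← NGe_update_sub (G i) x hef]
  ring

theorem condOne_update_self {n : ℕ} (x : Config n) (f : EdgeSet n) (b c : Bool) :
    condOne V G β (Function.update x f b) f = condOne V G β (Function.update x f c) f := by
  simp [condOne]

/-- A lower bound, on `T_δ`, for the discrete derivative at a one-edge modification. -/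
noncomputable def dHamLower (p δ : ℝ) (n : ℕ) : ℝ :=
  ∑ i, β i * (2 * numEdges (G i) * (p - δ) ^ (numEdges (G i) - 1) *
    (((n - 2).descFactorial (V i - 2) : ℕ) / (n : ℝ) ^ (V i - 2)) -
      (64 * (V i).choose 3 : ℕ) / (n : ℝ))

theorem tendsto_dHamLower (p δ : ℝ) :
    Tendsto (dHamLower V G β p δ) atTop (nhds (Psi V G β (p - δ))) := by
  have h : Psi V G β (p - δ) =
      ∑ i, β i * (2 * numEdges (G i) * (p - δ) ^ (numEdges (G i) - 1) * 1 - 0) := by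
    unfold Psi
    exact Finset.sum_congr rfl fun i _ => by ring
  rw [h]
  exact tendsto_finsetSum _ fun i _ =>
    (((tendsto_descFactorial_sub_two_div_pow _).const_mul _).sub
      (tendsto_const_div_atTop_nhds_zero_nat _)).const_mul _

variable {V G β}

theorem dHam_nonneg (hβ : ∀ i, 0 < β i) {n : ℕ} (e : EdgeSet n) (x : Config n) :
    0 ≤ dHam V G β e x := by
  rw [dHam_eq_sum]
  exact Finset.sum_nonneg fun i _ =>
    mul_nonneg (hβ i).le (div_nonneg (NGe_nonneg _ _ _) (by positivity))

theorem dHamLower_le (hβ : ∀ i, 0 < β i) {a : ℕ} (ha : ∀ i, V i ≤ a) {p δ : ℝ}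
    (hp : 0 ≤ p - δ) {n : ℕ} (hn : 0 < n) {x : Config n} (hx : memT a p δ x) {e f : EdgeSet n}
    (hef : e ≠ f) (b : Bool) :
    dHamLower V G β p δ n ≤ dHam V G β e (Function.update x f b) := by
  have hpair := dHam_update_sub V G β x hef
  have hpair0 : 0 ≤ ∑ i, β i * (NGpair (G i) x e f / (n : ℝ) ^ (V i - 2)) :=
    Finset.sum_nonneg fun i _ =>
      mul_nonneg (hβ i).le (div_nonneg (NGpair_nonneg _ _ _ _) (by positivity))
  have hmain : dHamLower V G β p δ n ≤
      dHam V G β e x - ∑ i, β i * (NGpair (G i) x e f / (n : ℝ) ^ (V i - 2)) := by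
    rw [dHam_eq_sum, ← Finset.sum_sub_distrib, dHamLower]
    refine Finset.sum_le_sum fun i _ => ?_
    rw [← mul_sub]
    exact mul_le_mul_of_nonneg_left (sub_le_sub (le_NGe_div_of_memT hn hp hx (ha i) _ e)
      (NGpair_div_le hn _ x hef)) (hβ i).le
  have hself := Function.update_eq_self f x
  cases hxf : x f <;> rw [hxf] at hself <;> rw [hself] at hpair <;> cases b <;>
    first | linarith | (rw [hself]; linarith)

theorem sum_abs_condOne_sub_le (hβ : ∀ i, 0 < β i) {a : ℕ} (ha : ∀ i, V i ≤ a) {p δ l : ℝ}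
    (hp : 0 ≤ p - δ) {n : ℕ} (hn : 0 < n) {x : Config n} (hx : memT a p δ x)
    (hl : l ≤ dHamLower V G β p δ n) (f : EdgeSet n) :
    ∑ e : EdgeSet n, |condOne V G β (Function.update x f true) e -
        condOne V G β (Function.update x f false) e| ≤
      Phi (max 0 l) * (1 - Phi (max 0 l)) * PsiDeriv V G β (p + δ) := by
  have hg : 0 ≤ Phi (max 0 l) * (1 - Phi (max 0 l)) :=
    mul_nonneg (Phi_mem_Ioo _).1.le (sub_nonneg.2 (Phi_mem_Ioo _).2.le)
  have hlow : ∀ {e : EdgeSet n}, e ≠ f → ∀ b : Bool,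
      max 0 l ≤ dHam V G β e (Function.update x f b) := fun hef b =>
    max_le (dHam_nonneg hβ _ _) (hl.trans (dHamLower_le hβ ha hp hn hx hef b))
  rw [← Finset.add_sum_erase _ _ (Finset.mem_univ f),
    condOne_update_self V G β x f true false, sub_self, abs_zero, zero_add]
  calc _ ≤ ∑ e ∈ Finset.univ.erase f, Phi (max 0 l) * (1 - Phi (max 0 l)) *
        ∑ i, β i * (NGpair (G i) x e f / (n : ℝ) ^ (V i - 2)) := by
        refine Finset.sum_le_sum fun e he => ?_
        have hef := Finset.ne_of_mem_erase he
        rw [condOne_eq_Phi_dHam, condOne_eq_Phi_dHam, ← dHam_update_sub V G β x hef]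
        refine (abs_Phi_sub_le (le_max_left 0 l) (hlow hef false) (hlow hef true)).trans_eq ?_
        rw [abs_of_nonneg]
        rw [dHam_update_sub V G β x hef]
        exact Finset.sum_nonneg fun i _ =>
          mul_nonneg (hβ i).le (div_nonneg (NGpair_nonneg _ _ _ _) (by positivity))
    _ = Phi (max 0 l) * (1 - Phi (max 0 l)) * ∑ i, β i *
        ∑ e ∈ Finset.univ.erase f, NGpair (G i) x e f / (n : ℝ) ^ (V i - 2) := by
        rw [← Finset.mul_sum, Finset.sum_comm]
        simp_rw [Finset.mul_sum]
    _ ≤ _ := by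
        refine mul_le_mul_of_nonneg_left (Finset.sum_le_sum fun i _ => ?_) hg
        refine (mul_le_mul_of_nonneg_left (sum_NGpair_div_le_of_memT hn hx (ha i) (G i) f)
          (hβ i).le).trans_eq ?_
        ring

end

theorem exists_contraction_constant {s : ℕ} {V : Fin s → ℕ} {G : ∀ i, SimpleGraph (Fin (V i))}
    {β : Fin s → ℝ} (hβ : ∀ i, 0 < β i) {p : ℝ} (hsub : Subcritical V G β p) :
    ∃ δ : ℝ, 0 < δ ∧ δ < p ∧ δ < 1 / 2 ∧
      Phi (max 0 (Psi V G β (p - δ) - δ)) * (1 - Phi (max 0 (Psi V G β (p - δ) - δ))) *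
        PsiDeriv V G β (p + δ) + 2 * δ < 1 := by
  obtain ⟨hfix, -, hderiv⟩ := hsub
  have hp : 0 < p := hfix ▸ (Phi_mem_Ioo _).1
  have hΨ : 0 ≤ Psi V G β p := Finset.sum_nonneg fun i _ => by
    have := hβ i
    positivity
  let F : ℝ → ℝ := fun δ =>
    Phi (max 0 (Psi V G β (p - δ) - δ)) * (1 - Phi (max 0 (Psi V G β (p - δ) - δ))) *
      PsiDeriv V G β (p + δ) + 2 * δ
  have hcont : Continuous F := by
    have h₁ := continuous_Phi
    have h₂ := continuous_Psi V G β
    have h₃ := continuous_PsiDeriv V G β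
    fun_prop
  have hF0 : F 0 < 1 := by
    rw [deriv_phiFn] at hderiv
    simpa [F, max_eq_right hΨ] using hderiv
  have hev := ((hcont.tendsto 0).eventually_lt_const hF0).and
    ((eventually_lt_nhds hp).and (eventually_lt_nhds (by norm_num : (0 : ℝ) < 1 / 2)))
  obtain ⟨δ, ⟨h₁, h₂, h₃⟩, h₀⟩ :=
    ((hev.filter_mono nhdsWithin_le_nhds).and (self_mem_nhdsWithin (s := Set.Ioi 0))).exists
  exact ⟨δ, h₀, h₂, h₃, h₁⟩

/-- **(Equation (205): the Dobrushin matrix `A(x)` contracts on `T_δ`).**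
If `β` is sub-critical, there is a small `δ > 0` such that for all sufficiently large
`n`, every `x ∈ T_δ` satisfies `‖A(x)‖₁ < 1 - δ`, where
`A(x)_{ef} = d_TV(π_e(·|x_{f+}), π_e(·|x_{f-}))`. -/
theorem dobrushin_matrix_on_T {s : ℕ} (V : Fin s → ℕ)
    (G : ∀ i, SimpleGraph (Fin (V i))) (β : Fin s → ℝ) (hβ : ∀ i, 0 < β i)
    (p : ℝ) (hsub : Subcritical V G β p) (a : ℕ) (ha : ∀ i, V i ≤ a) :
    ∃ δ : ℝ, 0 < δ ∧ ∃ N : ℕ, ∀ n : ℕ, N ≤ n →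
      ∀ x : Config n, memT a p δ x →
        colNorm (fun e f : EdgeSet n =>
          |condOne V G β (Function.update x f true) e -
            condOne V G β (Function.update x f false) e|) < 1 - δ := by
  obtain ⟨δ, hδ, hδp, hδ2, hlt⟩ := exists_contraction_constant hβ hsub
  obtain ⟨N, hN⟩ := eventually_atTop.1 ((eventually_gt_atTop 0).and
    ((tendsto_dHamLower V G β p δ).eventually_const_le (sub_lt_self _ hδ)))
  refine ⟨δ, hδ, N, fun n hn x hx => ?_⟩
  obtain ⟨hn0, hl⟩ := hN n hn
  refine lt_of_le_of_lt (b := 1 - 2 * δ) (Real.iSup_le (fun f => ?_) (by linarith)) (by linarith)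
  simp only [abs_abs]
  have := sum_abs_condOne_sub_le hβ ha (sub_nonneg.2 hδp.le) hn0 hx hl f
  linarith

end ERGM
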